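/- arXiv:2510.14019 — 7 statements merged into one kernel-verified Lean document; each statement's English description precedes it below -/
import Mathlib

section
/- Almost triangle inequality for the ρ-scale (Proposition 3.5, Assertion 3): Suppose (d_t)_{t∈I} satisfies condition (RF4) with constant K ≥ 1. Let ρ ≥ 2K, let ρ₁, ρ₂ ≥ ρ − K, and let x, y, z ∈ M. Assume either that I is unbounded below, or that (ρ₁·D_{ρ₁}(x,z) + ρ₂·D_{ρ₂}(z,y))/(ρ − K) < √(−inf I). Then, with the usual arithmetic conventions in [0,+∞], (ρ − K)·D_ρ(x,y) ≤ ρ₁·D_{ρ₁}(x,z) + ρ₂·D_{ρ₂}(z,y). In particular D_ρ(x,y) ≤ (max(ρ₁,ρ₂)/(ρ − K))·(D_{ρ₁}(x,z) + D_{ρ₂}(z,y)), and taking ρ₁ = ρ₂ = ρ − K one obtains D_ρ(x,y) ≤ D_{ρ−K}(x,z) + D_{ρ−K}(z,y). -/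
open scoped ENNReal

noncomputable section

/-- A family of distance functions `d t x y` on a set `M`, indexed by times `t` in a
set `I ⊆ ℝ` which is a nonempty interval with supremum `0`, such that `d t` is a
metric on `M` for every `t ∈ I`. -/
structure FlowMetric (M : Type*) (I : Set ℝ) where
  d : ℝ → M → M → ℝ
  ordConnected : I.OrdConnected
  nonempty : I.Nonempty
  isLUB_zero : IsLUB I 0
  d_self : ∀ t ∈ I, ∀ x : M, d t x x = 0
  eq_of_d_eq_zero : ∀ t ∈ I, ∀ x y : M, d t x y = 0 → x = y
  d_symm : ∀ t ∈ I, ∀ x y : M, d t x y = d t y x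
  d_triangle : ∀ t ∈ I, ∀ x y z : M, d t x z ≤ d t x y + d t y z

/-- Condition (RF4): the lower distance-distortion estimate with constant `K ≥ 1`:
`d_s(x,y) ≤ d_t(x,y) + K(√|s| − √|t|)` for all `s < t` in `I`. -/
def RF4 {M : Type*} {I : Set ℝ} (fm : FlowMetric M I) (K : ℝ) : Prop :=
  1 ≤ K ∧ ∀ x y : M, ∀ s ∈ I, ∀ t ∈ I, s < t →
    fm.d s x y ≤ fm.d t x y + K * (Real.sqrt |s| - Real.sqrt |t|)

/-- The set `I^ρ_{x,y}` of admissible scales: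
`{r > 0 : −r² ∈ I and d_{−r²}(x,y) < ρ·r}`. -/
def scaleSet {M : Type*} {I : Set ℝ} (fm : FlowMetric M I) (ρ : ℝ) (x y : M) : Set ℝ :=
  {r : ℝ | 0 < r ∧ -r ^ 2 ∈ I ∧ fm.d (-r ^ 2) x y < ρ * r}

/-- The `ρ`-scale `D_ρ(x,y) = inf I^ρ_{x,y} ∈ [0,+∞]`, equal to `+∞` when
`I^ρ_{x,y} = ∅`. -/
def Dscale {M : Type*} {I : Set ℝ} (fm : FlowMetric M I) (ρ : ℝ) (x y : M) : ℝ≥0∞ :=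
  ⨅ r ∈ scaleSet fm ρ x y, ENNReal.ofReal r

/-- The ball `B̃_ρ(x,r) = {y : d_{−r²}(x,y) < ρ·r}`. -/
def tball {M : Type*} {I : Set ℝ} (fm : FlowMetric M I) (ρ : ℝ) (x : M) (r : ℝ) : Set M :=
  {y : M | fm.d (-r ^ 2) x y < ρ * r}

/-- Condition (RF4) in terms of scales: from scale `a` to a larger scale `b` distances grow by at
most `K * (b - a)`. -/
lemma RF4.d_le {M : Type*} {I : Set ℝ} {fm : FlowMetric M I} {K : ℝ} (h : RF4 fm K) (x y : M)
    {a b : ℝ} (ha : 0 < a) (hab : a ≤ b) (haI : -a ^ 2 ∈ I) (hbI : -b ^ 2 ∈ I) :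
    fm.d (-b ^ 2) x y ≤ fm.d (-a ^ 2) x y + K * (b - a) := by
  rcases hab.eq_or_lt with rfl | hlt
  · simp
  · have hs := h.2 x y (-b ^ 2) hbI (-a ^ 2) haI (by nlinarith)
    rwa [abs_neg, abs_neg, abs_of_nonneg (sq_nonneg a), abs_of_nonneg (sq_nonneg b),
      Real.sqrt_sq ha.le, Real.sqrt_sq (ha.le.trans hab)] at hs

/-- Distances at two scales `r₁ ≤ r` and `r₂ ≤ r` combine to a distance at scale `r`, the
distortion being counted only once. -/
lemma RF4.d_triangle {M : Type*} {I : Set ℝ} {fm : FlowMetric M I} {K : ℝ} (h : RF4 fm K)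
    (x y z : M) {r₁ r₂ r : ℝ} (h₁ : 0 < r₁) (h₂ : 0 < r₂) (h₁r : r₁ ≤ r) (h₂r : r₂ ≤ r)
    (h₁I : -r₁ ^ 2 ∈ I) (h₂I : -r₂ ^ 2 ∈ I) (hrI : -r ^ 2 ∈ I) :
    fm.d (-r ^ 2) x y ≤
      fm.d (-r₁ ^ 2) x z + fm.d (-r₂ ^ 2) z y + K * (r - min r₁ r₂) := by
  rcases le_total r₁ r₂ with hle | hle
  · rw [min_eq_left hle]
    linarith [h.d_le x y h₂ h₂r h₂I hrI, h.d_le x z h₁ hle h₁I h₂I,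
      fm.d_triangle _ h₂I x z y]
  · rw [min_eq_right hle]
    linarith [h.d_le x y h₁ h₁r h₁I hrI, h.d_le z y h₂ hle h₂I h₁I,
      fm.d_triangle _ h₁I x z y]

lemma RF4.mem_scaleSet {M : Type*} {I : Set ℝ} {fm : FlowMetric M I} {K : ℝ} (h : RF4 fm K)
    {ρ ρ₁ ρ₂ : ℝ} (hρ : K < ρ) (hρ₁ : ρ - K ≤ ρ₁) (hρ₂ : ρ - K ≤ ρ₂) {x y z : M} {r₁ r₂ r : ℝ}
    (h₁ : r₁ ∈ scaleSet fm ρ₁ x z) (h₂ : r₂ ∈ scaleSet fm ρ₂ z y)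
    (hr : (ρ - K) * r = ρ₁ * r₁ + ρ₂ * r₂) (hI : ∃ t ∈ I, t ≤ -r ^ 2) :
    r ∈ scaleSet fm ρ x y := by
  obtain ⟨h₁0, h₁I, h₁d⟩ := h₁
  obtain ⟨h₂0, h₂I, h₂d⟩ := h₂
  have hK := h.1
  have hsum : r₁ + r₂ ≤ r := by
    refine le_of_mul_le_mul_left ?_ (sub_pos.2 hρ)
    rw [hr, mul_add]
    gcongr
  obtain ⟨t, htI, ht⟩ := hI
  have hrI : -r ^ 2 ∈ I := fm.ordConnected.out htI h₁I ⟨ht, by nlinarith⟩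
  refine ⟨by linarith, hrI, ?_⟩
  have hd := h.d_triangle x y z h₁0 h₂0 (by linarith) (by linarith) h₁I h₂I hrI
  have hmin : 0 < K * min r₁ r₂ := mul_pos (by linarith) (lt_min h₁0 h₂0)
  linarith

lemma exists_mem_scaleSet_of_lt {M : Type*} {I : Set ℝ} (fm : FlowMetric M I)
    {ρ₁ ρ₂ : ℝ} {x y z : M} {c : ℝ≥0∞}
    (h : ENNReal.ofReal ρ₁ * Dscale fm ρ₁ x z + ENNReal.ofReal ρ₂ * Dscale fm ρ₂ z y < c)
    (hρ₁ : 0 < ρ₁) (hρ₂ : 0 < ρ₂) :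
    ∃ r₁ ∈ scaleSet fm ρ₁ x z, ∃ r₂ ∈ scaleSet fm ρ₂ z y,
      ENNReal.ofReal (ρ₁ * r₁ + ρ₂ * r₂) < c := by
  have e₁ : ENNReal.ofReal ρ₁ ≠ 0 := by simpa using hρ₁
  have e₂ : ENNReal.ofReal ρ₂ ≠ 0 := by simpa using hρ₂
  simp only [Dscale, iInf_subtype', ENNReal.mul_iInf_of_ne e₁ ENNReal.ofReal_ne_top,
    ENNReal.mul_iInf_of_ne e₂ ENNReal.ofReal_ne_top, ENNReal.iInf_add, ENNReal.add_iInf,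
    iInf_lt_iff] at h
  obtain ⟨⟨r₂, h₂⟩, ⟨r₁, h₁⟩, hlt⟩ := h
  refine ⟨r₁, h₁, r₂, h₂, ?_⟩
  rwa [ENNReal.ofReal_add (mul_pos hρ₁ h₁.1).le (mul_pos hρ₂ h₂.1).le,
    ENNReal.ofReal_mul hρ₁.le, ENNReal.ofReal_mul hρ₂.le]

lemma exists_mem_le_neg_sq {I : Set ℝ} (hI : I.Nonempty) {r : ℝ}
    (h : ¬ BddBelow I ∨ ENNReal.ofReal r < ENNReal.ofReal (Real.sqrt (-sInf I))) (hr : 0 ≤ r) :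
    ∃ t ∈ I, t ≤ -r ^ 2 := by
  rcases h with h | h
  · obtain ⟨t, ht, hlt⟩ := not_bddBelow_iff.1 h (-r ^ 2)
    exact ⟨t, ht, hlt.le⟩
  · have hlt := (Real.lt_sqrt hr).1 (ENNReal.ofReal_lt_ofReal_iff'.1 h).1
    obtain ⟨t, ht, hlt⟩ := exists_lt_of_csInf_lt hI (show sInf I < -r ^ 2 by linarith)
    exact ⟨t, ht, hlt.le⟩

/-- **Almost triangle inequality for the ρ-scale** (Proposition 3.5, Assertion 3).
Assume (RF4) with constant `K ≥ 1`, `ρ ≥ 2K`, `ρ₁, ρ₂ ≥ ρ − K`, and either `I` is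
unbounded below or `(ρ₁·D_{ρ₁}(x,z) + ρ₂·D_{ρ₂}(z,y))/(ρ − K) < √(−inf I)`. Then
`(ρ − K)·D_ρ(x,y) ≤ ρ₁·D_{ρ₁}(x,z) + ρ₂·D_{ρ₂}(z,y)`; in particular
`D_ρ(x,y) ≤ (max(ρ₁,ρ₂)/(ρ − K))·(D_{ρ₁}(x,z) + D_{ρ₂}(z,y))`, and if
`ρ₁ = ρ₂ = ρ − K` then `D_ρ(x,y) ≤ D_{ρ−K}(x,z) + D_{ρ−K}(z,y)`. -/
theorem Dscale_almost_triangle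
    {M : Type*} {I : Set ℝ} (fm : FlowMetric M I) {K : ℝ} (hRF4 : RF4 fm K)
    {ρ ρ₁ ρ₂ : ℝ} (hρ : 2 * K ≤ ρ) (hρ₁ : ρ - K ≤ ρ₁) (hρ₂ : ρ - K ≤ ρ₂)
    (x y z : M)
    (hI : ¬ BddBelow I ∨
      (ENNReal.ofReal ρ₁ * Dscale fm ρ₁ x z + ENNReal.ofReal ρ₂ * Dscale fm ρ₂ z y)
          / ENNReal.ofReal (ρ - K)
        < ENNReal.ofReal (Real.sqrt (-sInf I))) :
    ENNReal.ofReal (ρ - K) * Dscale fm ρ x y ≤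
        ENNReal.ofReal ρ₁ * Dscale fm ρ₁ x z + ENNReal.ofReal ρ₂ * Dscale fm ρ₂ z y ∧
      Dscale fm ρ x y ≤ ENNReal.ofReal (max ρ₁ ρ₂ / (ρ - K)) *
        (Dscale fm ρ₁ x z + Dscale fm ρ₂ z y) ∧
      (ρ₁ = ρ - K → ρ₂ = ρ - K →
        Dscale fm ρ x y ≤ Dscale fm (ρ - K) x z + Dscale fm (ρ - K) z y) := by
  have hK := hRF4.1
  have hc : 0 < ρ - K := by linarith
  have hc0 : ENNReal.ofReal (ρ - K) ≠ 0 := by simpa using hc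
  have hct : ENNReal.ofReal (ρ - K) ≠ ∞ := ENNReal.ofReal_ne_top
  have main : ENNReal.ofReal (ρ - K) * Dscale fm ρ x y ≤
      ENNReal.ofReal ρ₁ * Dscale fm ρ₁ x z + ENNReal.ofReal ρ₂ * Dscale fm ρ₂ z y := by
    rw [mul_comm, ← ENNReal.le_div_iff_mul_le (Or.inl hc0) (Or.inl hct)]
    have key : ∀ c : ℝ≥0∞, (ENNReal.ofReal ρ₁ * Dscale fm ρ₁ x z +
        ENNReal.ofReal ρ₂ * Dscale fm ρ₂ z y) / ENNReal.ofReal (ρ - K) < c →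
        (¬ BddBelow I ∨ c ≤ ENNReal.ofReal (Real.sqrt (-sInf I))) → Dscale fm ρ x y ≤ c := by
      intro c hlt hcI
      rw [ENNReal.div_lt_iff (Or.inl hc0) (Or.inl hct)] at hlt
      obtain ⟨r₁, h₁, r₂, h₂, hr⟩ :=
        exists_mem_scaleSet_of_lt fm hlt (by linarith) (by linarith)
      rw [← ENNReal.div_lt_iff (Or.inl hc0) (Or.inl hct), ← ENNReal.ofReal_div_of_pos hc] at hr
      have hr0 : 0 ≤ (ρ₁ * r₁ + ρ₂ * r₂) / (ρ - K) :=
        div_nonneg (add_nonneg (mul_nonneg (by linarith) h₁.1.le)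
          (mul_nonneg (by linarith) h₂.1.le)) hc.le
      have hmem := hRF4.mem_scaleSet (by linarith) hρ₁ hρ₂ h₁ h₂
        (mul_div_cancel₀ _ hc.ne') (exists_mem_le_neg_sq fm.nonempty (hcI.imp_right hr.trans_le) hr0)
      exact (iInf₂_le _ hmem).trans hr.le
    rcases hI with hI | hI
    · exact le_of_forall_gt_imp_ge_of_dense fun c hlt => key c hlt (Or.inl hI)
    · refine le_of_forall_gt_imp_ge_of_dense fun c hlt => ?_
      exact (key _ (lt_min hlt hI) (Or.inr (min_le_right _ _))).trans (min_le_left _ _)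
  have hmax : Dscale fm ρ x y ≤ ENNReal.ofReal (max ρ₁ ρ₂ / (ρ - K)) *
      (Dscale fm ρ₁ x z + Dscale fm ρ₂ z y) := by
    rw [ENNReal.ofReal_div_of_pos hc, ← ENNReal.mul_div_right_comm,
      ENNReal.le_div_iff_mul_le (Or.inl hc0) (Or.inl hct), mul_comm, mul_add]
    refine main.trans ?_
    gcongr
    · exact le_max_left _ _
    · exact le_max_right _ _
  refine ⟨main, hmax, ?_⟩
  rintro rfl rfl
  simpa [div_self hc.ne'] using hmax
end
end

section
/- Comparison of ρ-scales (Proposition 3.5, Assertion 4): Suppose (d_t)_{t∈I} satisfies condition (RF4) with constant K ≥ 1 and let K < ρ₁ ≤ ρ₂. Then for all x,y ∈ M one has D_{ρ₂}(x,y) ≤ D_{ρ₁}(x,y); and if moreover I is unbounded below, or ((ρ₂ − K)/(ρ₁ − K))·D_{ρ₂}(x,y) < √(−inf I), then additionally D_{ρ₁}(x,y) ≤ ((ρ₂ − K)/(ρ₁ − K))·D_{ρ₂}(x,y). -/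
open scoped ENNReal

noncomputable section

/-- A larger `ρ` admits more scales. -/
lemma scaleSet_mono {M : Type*} {I : Set ℝ} (fm : FlowMetric M I) {ρ₁ ρ₂ : ℝ}
    (h : ρ₁ ≤ ρ₂) (x y : M) : scaleSet fm ρ₁ x y ⊆ scaleSet fm ρ₂ x y := by
  rintro r ⟨hr, hrI, hd⟩
  exact ⟨hr, hrI, hd.trans_le (mul_le_mul_of_nonneg_right h hr.le)⟩

/-- Under (RF4), enlarging an admissible `ρ₂`-scale by the factor `(ρ₂ - K) / (ρ₁ - K)` yields
an admissible `ρ₁`-scale, as long as the resulting time still belongs to `I`. -/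
lemma mul_mem_scaleSet {M : Type*} {I : Set ℝ} {fm : FlowMetric M I} {K : ℝ} (hRF4 : RF4 fm K)
    {ρ₁ ρ₂ : ℝ} (h₁ : K < ρ₁) (h₁₂ : ρ₁ ≤ ρ₂) {x y : M} {r : ℝ}
    (hr : r ∈ scaleSet fm ρ₂ x y) (hI : -((ρ₂ - K) / (ρ₁ - K) * r) ^ 2 ∈ I) :
    (ρ₂ - K) / (ρ₁ - K) * r ∈ scaleSet fm ρ₁ x y := by
  rcases h₁₂.eq_or_lt with rfl | h₁₂
  · rwa [div_self (sub_pos.2 h₁).ne', one_mul]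
  obtain ⟨hr0, hrI, hd⟩ := hr
  have hK : 0 < ρ₁ - K := sub_pos.2 h₁
  set c := (ρ₂ - K) / (ρ₁ - K) with hc
  have hc1 : 1 < c := (one_lt_div hK).2 (by linarith)
  have hcK : c * (ρ₁ - K) = ρ₂ - K := div_mul_cancel₀ _ hK.ne'
  have hcr : 0 < c * r := by positivity
  have hlt : r < c * r := lt_mul_of_one_lt_left hr0 hc1
  have hdist := hRF4.2 x y _ hI _ hrI (neg_lt_neg (pow_lt_pow_left₀ hlt hr0.le two_ne_zero))
  rw [abs_neg, abs_neg, abs_sq, abs_sq, Real.sqrt_sq hcr.le, Real.sqrt_sq hr0.le] at hdist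
  refine ⟨hcr, hI, ?_⟩
  linear_combination hdist + hd - r * hcK

/-- Under (RF4), an admissible `ρ₂`-scale bounds the `ρ₁`-scale up to the factor
`(ρ₂ - K) / (ρ₁ - K)`, as long as `I` reaches back past the enlarged time. -/
lemma Dscale_le_of_mem_scaleSet {M : Type*} {I : Set ℝ} {fm : FlowMetric M I} {K : ℝ}
    (hRF4 : RF4 fm K) {ρ₁ ρ₂ : ℝ} (h₁ : K < ρ₁) (h₁₂ : ρ₁ ≤ ρ₂) {x y : M} {r : ℝ}
    (hr : r ∈ scaleSet fm ρ₂ x y)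
    (hI : ∃ z ∈ I, z < -((ρ₂ - K) / (ρ₁ - K) * r) ^ 2) :
    Dscale fm ρ₁ x y ≤ ENNReal.ofReal ((ρ₂ - K) / (ρ₁ - K)) * ENNReal.ofReal r := by
  obtain ⟨z, hz, hzlt⟩ := hI
  have hc : 1 ≤ (ρ₂ - K) / (ρ₁ - K) := (one_le_div (sub_pos.2 h₁)).2 (by linarith)
  have hle : r ≤ (ρ₂ - K) / (ρ₁ - K) * r := le_mul_of_one_le_left hr.1.le hc
  have hmem := fm.ordConnected.out hz hr.2.1
    ⟨hzlt.le, neg_le_neg (pow_le_pow_left₀ hr.1.le hle 2)⟩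
  rw [← ENNReal.ofReal_mul (zero_le_one.trans hc)]
  exact iInf₂_le _ (mul_mem_scaleSet hRF4 h₁ h₁₂ hr hmem)

/-- **Comparison of ρ-scales** (Proposition 3.5, Assertion 4).
Under (RF4) with constant `K ≥ 1` and `K < ρ₁ ≤ ρ₂`: `D_{ρ₂}(x,y) ≤ D_{ρ₁}(x,y)`;
and if moreover `I` is unbounded below, or
`((ρ₂ − K)/(ρ₁ − K))·D_{ρ₂}(x,y) < √(−inf I)`, then additionally
`D_{ρ₁}(x,y) ≤ ((ρ₂ − K)/(ρ₁ − K))·D_{ρ₂}(x,y)`. -/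
theorem Dscale_comparison
    {M : Type*} {I : Set ℝ} (fm : FlowMetric M I) {K : ℝ} (hRF4 : RF4 fm K)
    {ρ₁ ρ₂ : ℝ} (h₁ : K < ρ₁) (h₁₂ : ρ₁ ≤ ρ₂) (x y : M) :
    Dscale fm ρ₂ x y ≤ Dscale fm ρ₁ x y ∧
      ((¬ BddBelow I ∨
          ENNReal.ofReal ((ρ₂ - K) / (ρ₁ - K)) * Dscale fm ρ₂ x y
            < ENNReal.ofReal (Real.sqrt (-sInf I))) →
        Dscale fm ρ₁ x y ≤ ENNReal.ofReal ((ρ₂ - K) / (ρ₁ - K)) * Dscale fm ρ₂ x y) := by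
  refine ⟨biInf_mono (scaleSet_mono fm h₁₂ x y), fun h => ?_⟩
  have hc : 0 < (ρ₂ - K) / (ρ₁ - K) := div_pos (by linarith) (sub_pos.2 h₁)
  have hmul : ENNReal.ofReal ((ρ₂ - K) / (ρ₁ - K)) * Dscale fm ρ₂ x y =
      ⨅ r ∈ scaleSet fm ρ₂ x y,
        ENNReal.ofReal ((ρ₂ - K) / (ρ₁ - K)) * ENNReal.ofReal r := by
    simp only [Dscale, ENNReal.mul_iInf_of_ne (ENNReal.ofReal_pos.2 hc).ne' ENNReal.ofReal_ne_top]
  rw [hmul] at h ⊢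
  rcases h with hunb | hlt
  · exact le_iInf₂ fun r hr =>
      Dscale_le_of_mem_scaleSet hRF4 h₁ h₁₂ hr (not_bddBelow_iff.1 hunb _)
  have hsmall : ∀ r ∈ scaleSet fm ρ₂ x y,
      ENNReal.ofReal ((ρ₂ - K) / (ρ₁ - K)) * ENNReal.ofReal r
        < ENNReal.ofReal (Real.sqrt (-sInf I)) →
      Dscale fm ρ₁ x y ≤ ENNReal.ofReal ((ρ₂ - K) / (ρ₁ - K)) * ENNReal.ofReal r := by
    intro r hr hrlt
    refine Dscale_le_of_mem_scaleSet hRF4 h₁ h₁₂ hr (exists_lt_of_csInf_lt fm.nonempty ?_)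
    have hcr : 0 ≤ (ρ₂ - K) / (ρ₁ - K) * r := mul_nonneg hc.le hr.1.le
    rw [← ENNReal.ofReal_mul hc.le, ENNReal.ofReal_lt_ofReal_iff_of_nonneg hcr,
      Real.lt_sqrt hcr] at hrlt
    linarith
  obtain ⟨r', hr', hlt'⟩ := by simpa only [iInf_lt_iff, exists_prop] using hlt
  refine le_iInf₂ fun r hr => ?_
  rcases lt_or_ge (ENNReal.ofReal ((ρ₂ - K) / (ρ₁ - K)) * ENNReal.ofReal r)
    (ENNReal.ofReal (Real.sqrt (-sInf I))) with hrlt | hge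
  · exact hsmall r hr hrlt
  · exact (hsmall r' hr' hlt').trans (hlt'.le.trans hge)
end
end

section
/- Maximum inequality for the ρ-scale (Proposition 3.5, Assertion 5): Suppose (d_t)_{t∈I} satisfies condition (RF4) with constant K ≥ 1 and let ρ₁, ρ₂ ≥ 2K. Then for all x, y, z ∈ M one has D_{ρ₁+ρ₂}(x,z) ≤ max(D_{ρ₁}(x,y), D_{ρ₂}(y,z)), as an inequality in [0,+∞]. -/
open scoped ENNReal

noncomputable section

/-- Under (RF4) with constant `K ≤ ρ`, admissibility of a scale passes to every larger scale `s`
with `−s² ∈ I`. -/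
lemma scaleSet_of_le {M : Type*} {I : Set ℝ} {fm : FlowMetric M I} {K : ℝ} (hRF4 : RF4 fm K)
    {ρ : ℝ} (hK : K ≤ ρ) {x y : M} {r s : ℝ} (hr : r ∈ scaleSet fm ρ x y) (hrs : r ≤ s)
    (hs : -s ^ 2 ∈ I) : s ∈ scaleSet fm ρ x y := by
  rcases hrs.eq_or_lt with rfl | hlt
  · exact hr
  obtain ⟨hr0, hrI, hrd⟩ := hr
  have hs0 : 0 < s := hr0.trans hlt
  refine ⟨hs0, hs, ?_⟩
  have h := hRF4.2 x y _ hs _ hrI (by nlinarith)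
  rw [abs_neg, abs_neg, abs_of_nonneg (sq_nonneg s), abs_of_nonneg (sq_nonneg r),
    Real.sqrt_sq hs0.le, Real.sqrt_sq hr0.le] at h
  nlinarith [mul_le_mul_of_nonneg_right hK (sub_nonneg.2 hrs)]

/-- A common admissible scale for `(x, y)` and `(y, z)` is admissible for `(x, z)`. -/
lemma scaleSet_add {M : Type*} {I : Set ℝ} {fm : FlowMetric M I} {ρ₁ ρ₂ : ℝ} {x y z : M} {r : ℝ}
    (h₁ : r ∈ scaleSet fm ρ₁ x y) (h₂ : r ∈ scaleSet fm ρ₂ y z) :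
    r ∈ scaleSet fm (ρ₁ + ρ₂) x z := by
  refine ⟨h₁.1, h₁.2.1, ?_⟩
  linarith [fm.d_triangle _ h₁.2.1 x y z, h₁.2.2, h₂.2.2, add_mul ρ₁ ρ₂ r]

lemma Dscale_lt_iff {M : Type*} {I : Set ℝ} {fm : FlowMetric M I} {ρ : ℝ} {x y : M} {c : ℝ≥0∞} :
    Dscale fm ρ x y < c ↔ ∃ r ∈ scaleSet fm ρ x y, ENNReal.ofReal r < c := by
  simp only [Dscale, iInf_lt_iff, exists_prop]

/-- **Maximum inequality for the ρ-scale** (Proposition 3.5, Assertion 5).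
Under (RF4) with constant `K ≥ 1` and `ρ₁, ρ₂ ≥ 2K`, for all `x, y, z ∈ M`:
`D_{ρ₁+ρ₂}(x,z) ≤ max(D_{ρ₁}(x,y), D_{ρ₂}(y,z))`, as an inequality in `[0,+∞]`. -/
theorem Dscale_le_max
    {M : Type*} {I : Set ℝ} (fm : FlowMetric M I) {K : ℝ} (hRF4 : RF4 fm K)
    {ρ₁ ρ₂ : ℝ} (h₁ : 2 * K ≤ ρ₁) (h₂ : 2 * K ≤ ρ₂) (x y z : M) :
    Dscale fm (ρ₁ + ρ₂) x z ≤ max (Dscale fm ρ₁ x y) (Dscale fm ρ₂ y z) := by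
  have hK := hRF4.1
  refine le_of_forall_gt fun c hc ↦ ?_
  obtain ⟨hc₁, hc₂⟩ := max_lt_iff.1 hc
  obtain ⟨r, hr, hrc⟩ := Dscale_lt_iff.1 hc₁
  obtain ⟨s, hs, hsc⟩ := Dscale_lt_iff.1 hc₂
  rw [Dscale_lt_iff]
  rcases le_total r s with h | h
  · exact ⟨s, scaleSet_add (scaleSet_of_le hRF4 (by linarith) hr h hs.2.1) hs, hsc⟩
  · exact ⟨r, scaleSet_add hr (scaleSet_of_le hRF4 (by linarith) hs h hr.2.1), hrc⟩
end
end

section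
/- Interval structure of the admissible-scale set (Lemma 3.1, second part): Suppose (d_t)_{t∈I} satisfies condition (RF4) with constant K ≥ 1 and let ρ ≥ K. Then for all x, y ∈ M the set I^ρ_{x,y} is upward closed: if r ∈ I^ρ_{x,y}, r' ≥ r and −r'² ∈ I, then r' ∈ I^ρ_{x,y}. Consequently, if I^ρ_{x,y} is nonempty, then it is an interval whose infimum is D_ρ(x,y) and which contains every r > D_ρ(x,y) with −r² ∈ I. -/
open scoped ENNReal

noncomputable section

/-- Under (RF4) with constant `K ≤ ρ`, admissibility of a scale passes to larger scales. -/
theorem mem_scaleSet_of_le {M : Type*} {I : Set ℝ} {fm : FlowMetric M I} {K ρ : ℝ}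
    (hRF4 : RF4 fm K) (hρ : K ≤ ρ) {x y : M} {r s : ℝ} (hr : r ∈ scaleSet fm ρ x y)
    (hrs : r ≤ s) (hsI : -s ^ 2 ∈ I) : s ∈ scaleSet fm ρ x y := by
  obtain ⟨hr0, hrI, hd⟩ := hr
  rcases hrs.eq_or_lt with rfl | hlt
  · exact ⟨hr0, hrI, hd⟩
  have hs0 : 0 < s := hr0.trans hlt
  refine ⟨hs0, hsI, ?_⟩
  have h := hRF4.2 x y _ hsI _ hrI (by nlinarith)
  rw [abs_neg, abs_neg, abs_sq, abs_sq, Real.sqrt_sq hs0.le, Real.sqrt_sq hr0.le] at h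
  nlinarith [mul_le_mul_of_nonneg_right hρ (sub_nonneg.2 hrs)]

/-- **Interval structure of the admissible-scale set** (Lemma 3.1, second part).
Under (RF4) with constant `K ≥ 1` and `ρ ≥ K`, the set `I^ρ_{x,y}` is upward
closed: if `r ∈ I^ρ_{x,y}`, `r' ≥ r` and `−r'² ∈ I`, then `r' ∈ I^ρ_{x,y}`.
Consequently, if `I^ρ_{x,y}` is nonempty, then it is an interval (order-connected)
whose infimum is `D_ρ(x,y)`, and it contains every `r > D_ρ(x,y)` with `−r² ∈ I`. -/
theorem scaleSet_structure
    {M : Type*} {I : Set ℝ} (fm : FlowMetric M I) {K : ℝ} (hRF4 : RF4 fm K)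
    {ρ : ℝ} (hρ : K ≤ ρ) (x y : M) :
    (∀ r ∈ scaleSet fm ρ x y, ∀ r' : ℝ, r ≤ r' → -r' ^ 2 ∈ I →
        r' ∈ scaleSet fm ρ x y) ∧
      ((scaleSet fm ρ x y).Nonempty →
        (scaleSet fm ρ x y).OrdConnected ∧
          ENNReal.ofReal (sInf (scaleSet fm ρ x y)) = Dscale fm ρ x y ∧
          ∀ r : ℝ, -r ^ 2 ∈ I → Dscale fm ρ x y < ENNReal.ofReal r →
            r ∈ scaleSet fm ρ x y) := by
  have hup : ∀ r ∈ scaleSet fm ρ x y, ∀ r' : ℝ, r ≤ r' → -r' ^ 2 ∈ I →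
      r' ∈ scaleSet fm ρ x y := fun _ hr _ => mem_scaleSet_of_le hRF4 hρ hr
  refine ⟨hup, fun hne => ⟨⟨fun a ha b hb c hc => ?_⟩, ?_, fun r hrI hr => ?_⟩⟩
  · have hc0 : 0 < c := ha.1.trans_le hc.1
    refine hup a ha c hc.1 (fm.ordConnected.out hb.2.1 ha.2.1 ⟨?_, ?_⟩)
    · exact neg_le_neg (pow_le_pow_left₀ hc0.le hc.2 2)
    · exact neg_le_neg (pow_le_pow_left₀ ha.1.le hc.1 2)
  · rw [Monotone.map_csInf_of_continuousAt ENNReal.continuous_ofReal.continuousAt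
      (fun _ _ => ENNReal.ofReal_le_ofReal) hne ⟨0, fun r hr => hr.1.le⟩, sInf_image]
    rfl
  · simp only [Dscale, iInf_lt_iff] at hr
    obtain ⟨s, hs, hsr⟩ := hr
    exact hup s hs r (ENNReal.ofReal_lt_ofReal_iff'.1 hsr).1.le hrI
end
end

section
/- The ρ-scale to a fixed point is ρ-scale Lipschitz (Remark after Definition 3.7): Suppose (d_t)_{t∈I} satisfies condition (RF4) with constant K ≥ 1, that I is unbounded below, and let ρ ≥ 2K and p ∈ M. Then the function x ↦ D_ρ(p,x) is ρ-scale (ρ/(ρ−K), ρ/(ρ−K))-Lipschitz; that is, for all x, y ∈ M, D_ρ(p,x) ≤ (ρ/(ρ−K))·D_ρ(p,y) + (ρ/(ρ−K))·D_ρ(x,y), as an inequality in [0,+∞]. -/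
open scoped ENNReal

noncomputable section

theorem FlowMetric.neg_sq_mem_of_le {M : Type*} {I : Set ℝ} (fm : FlowMetric M I)
    (hI : ¬ BddBelow I) {r R : ℝ} (hr : 0 < r) (hrI : -r ^ 2 ∈ I) (h : r ≤ R) :
    -R ^ 2 ∈ I := by
  obtain ⟨t, htI, ht⟩ := not_bddBelow_iff.mp hI (-R ^ 2)
  exact fm.ordConnected.out htI hrI ⟨ht.le, by nlinarith⟩

theorem RF4.d_neg_sq_le {M : Type*} {I : Set ℝ} {fm : FlowMetric M I} {K : ℝ}
    (h : RF4 fm K) {r R : ℝ} (hr : 0 < r) (hrR : r ≤ R) (hrI : -r ^ 2 ∈ I)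
    (hRI : -R ^ 2 ∈ I) (x y : M) :
    fm.d (-R ^ 2) x y ≤ fm.d (-r ^ 2) x y + K * (R - r) := by
  rcases hrR.eq_or_lt with rfl | hlt
  · simp
  · have key := h.2 x y (-R ^ 2) hRI (-r ^ 2) hrI (by nlinarith)
    rwa [abs_neg, abs_neg, abs_of_nonneg (sq_nonneg R), abs_of_nonneg (sq_nonneg r),
      Real.sqrt_sq (hr.trans hlt).le, Real.sqrt_sq hr.le] at key

/-- Compare both distances at the larger of the two scales, apply the triangle inequality
there, and only then pass to the scale `ρ / (ρ - K) * (r + s)`. -/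
theorem mul_add_mem_scaleSet {M : Type*} {I : Set ℝ} {fm : FlowMetric M I} {K : ℝ}
    (h : RF4 fm K) (hI : ¬ BddBelow I) {ρ : ℝ} (hρ : K < ρ) {p x y : M} {r s : ℝ}
    (hr : r ∈ scaleSet fm ρ p y) (hs : s ∈ scaleSet fm ρ x y) :
    ρ / (ρ - K) * (r + s) ∈ scaleSet fm ρ p x := by
  obtain ⟨hr0, hrI, hrd⟩ := hr
  obtain ⟨hs0, hsI, hsd⟩ := hs
  have hK := h.1
  have hpos : 0 < ρ - K := by linarith
  set R := ρ / (ρ - K) * (r + s) with hR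
  have hRe : (ρ - K) * R = ρ * (r + s) := by
    rw [hR]; field_simp
  have hle : r + s ≤ R :=
    le_mul_of_one_le_left (by linarith) ((one_le_div hpos).mpr (by linarith))
  have hRI := fm.neg_sq_mem_of_le hI hr0 hrI (by linarith : r ≤ R)
  refine ⟨by linarith, hRI, ?_⟩
  rcases le_total s r with hsr | hrs
  · have h₁ := h.d_neg_sq_le hs0 hsr hsI hrI x y
    have h₂ := h.d_neg_sq_le hr0 (by linarith) hrI hRI p x
    have h₃ := fm.d_triangle _ hrI p y x
    rw [fm.d_symm _ hrI y x] at h₃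
    nlinarith
  · have h₁ := h.d_neg_sq_le hr0 hrs hrI hsI p y
    have h₂ := h.d_neg_sq_le hs0 (by linarith) hsI hRI p x
    have h₃ := fm.d_triangle _ hsI p y x
    rw [fm.d_symm _ hsI y x] at h₃
    nlinarith

/-- **The ρ-scale to a fixed point is ρ-scale Lipschitz** (Remark after
Definition 3.7). Under (RF4) with constant `K ≥ 1`, with `I` unbounded below and
`ρ ≥ 2K`, for every `p ∈ M` the function `x ↦ D_ρ(p,x)` is ρ-scale
`(ρ/(ρ−K), ρ/(ρ−K))`-Lipschitz:
`D_ρ(p,x) ≤ (ρ/(ρ−K))·D_ρ(p,y) + (ρ/(ρ−K))·D_ρ(x,y)` in `[0,+∞]`. -/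
theorem Dscale_to_point_lipschitz
    {M : Type*} {I : Set ℝ} (fm : FlowMetric M I) {K : ℝ} (hRF4 : RF4 fm K)
    (hI : ¬ BddBelow I) {ρ : ℝ} (hρ : 2 * K ≤ ρ) (p x y : M) :
    Dscale fm ρ p x ≤
      ENNReal.ofReal (ρ / (ρ - K)) * Dscale fm ρ p y +
        ENNReal.ofReal (ρ / (ρ - K)) * Dscale fm ρ x y := by
  have hK := hRF4.1
  have hc : 0 < ρ / (ρ - K) := div_pos (by linarith) (by linarith)
  have hc0 : ENNReal.ofReal (ρ / (ρ - K)) ≠ 0 := (ENNReal.ofReal_pos.mpr hc).ne'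
  rw [← mul_add]
  simp only [Dscale.eq_def _ _ _ y, ENNReal.iInf_add, ENNReal.add_iInf,
    ENNReal.mul_iInf_of_ne hc0 ENNReal.ofReal_ne_top]
  refine le_iInf₂ fun s hs => le_iInf₂ fun r hr => ?_
  rw [← ENNReal.ofReal_add hr.1.le hs.1.le, ← ENNReal.ofReal_mul hc.le]
  exact iInf₂_le _ (mul_add_mem_scaleSet hRF4 hI (by linarith) hr hs)
end
end

section
/- Nested-ball inclusions (Lemma 3.9): Let (d_t)_{t∈[−1,0]} be a family of metrics on M satisfying condition (RF4) with constant K ≥ 1, let p ∈ M and let R ≥ 12K. Then for every integer i ≥ 5 and r = 2^{−i} (indeed for every 0 < r ≤ 2^{−5}) the following inclusions hold: (1) for every z ∈ B̃_{3R/2}(p,1), B̃_{2R}(z, r) ⊆ B̃_{5R/3}(p,1); (2) for every z ∈ B̃_{5R/3}(p,1), B̃_{2R}(z, 2r) ⊆ B̃_{2R}(p,1). -/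
open scoped ENNReal

noncomputable section

/-- Under (RF4), a ball of radius `ρ * r` at time `-r ^ 2` based at a point of a ball about `p`
at time `-1` lies in the ball about `p` at time `-1` with radius enlarged by
`ρ * r + K * (1 - r)`. -/
theorem mem_tball_one_of_mem_tball {M : Type*} (fm : FlowMetric M (Set.Icc (-1 : ℝ) 0)) {K : ℝ}
    (hRF4 : RF4 fm K) {a b ρ r : ℝ} (hr : 0 < r) (hr1 : r < 1) {p y z : M}
    (hz : z ∈ tball fm a p 1) (hy : y ∈ tball fm ρ z r) (hb : a + ρ * r + K * (1 - r) ≤ b) :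
    y ∈ tball fm b p 1 := by
  simp only [tball, Set.mem_ofPred_eq, one_pow, mul_one] at hz hy ⊢
  have h1 : (-1 : ℝ) ∈ Set.Icc (-1 : ℝ) 0 := by norm_num
  have h2 : -r ^ 2 ∈ Set.Icc (-1 : ℝ) 0 := ⟨by nlinarith, by nlinarith⟩
  have h3 := hRF4.2 z y (-1) h1 (-r ^ 2) h2 (by nlinarith)
  rw [abs_neg, abs_neg, abs_one, Real.sqrt_one, abs_of_nonneg (sq_nonneg r),
    Real.sqrt_sq hr.le] at h3
  linarith [fm.d_triangle (-1) h1 p z y]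

/-- **Nested-ball inclusions** (Lemma 3.9). Let `(d_t)_{t ∈ [−1,0]}` satisfy (RF4)
with constant `K ≥ 1`, let `p ∈ M` and `R ≥ 12K`. Then for every `0 < r ≤ 2⁻⁵`:
(1) for every `z ∈ B̃_{3R/2}(p,1)`, `B̃_{2R}(z, r) ⊆ B̃_{5R/3}(p,1)`;
(2) for every `z ∈ B̃_{5R/3}(p,1)`, `B̃_{2R}(z, 2r) ⊆ B̃_{2R}(p,1)`. -/
theorem nested_ball_inclusions
    {M : Type*} (fm : FlowMetric M (Set.Icc (-1 : ℝ) 0)) {K : ℝ} (hRF4 : RF4 fm K)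
    {R : ℝ} (hR : 12 * K ≤ R) (p : M) :
    ∀ r : ℝ, 0 < r → r ≤ (2 : ℝ) ^ (-(5 : ℤ)) →
      (∀ z ∈ tball fm (3 * R / 2) p 1,
        tball fm (2 * R) z r ⊆ tball fm (5 * R / 3) p 1) ∧
      (∀ z ∈ tball fm (5 * R / 3) p 1,
        tball fm (2 * R) z (2 * r) ⊆ tball fm (2 * R) p 1) := by
  intro r hr hr5
  have hr32 : r ≤ 1 / 32 := by norm_num at hr5 ⊢; exact hr5
  have hK : 1 ≤ K := hRF4.1
  have hRr : R * r ≤ R * (1 / 32) := mul_le_mul_of_nonneg_left hr32 (by linarith)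
  have hKr : 0 ≤ K * r := by positivity
  refine ⟨fun z hz y hy => ?_, fun z hz y hy => ?_⟩
  · exact mem_tball_one_of_mem_tball fm hRF4 hr (by linarith) hz hy (by linarith)
  · exact mem_tball_one_of_mem_tball fm hRF4 (by linarith) (by linarith) hz hy (by linarith)
end
end

section
/- Absence of independent subsets forces proximity to a plane (Remark 2.2): For every positive integer n, every integer 1 ≤ k ≤ n and every ε > 0, there exists δ₀ = δ₀(n, ε) > 0 such that for every 0 < δ ≤ δ₀ and every R > 0 the following holds: if X ⊆ B(0,R) ⊆ ℝⁿ contains no (k+1)-point subset that is (k,δ)-independent in B(0,R), then there exists an affine subspace L ⊆ ℝⁿ of dimension k−1 such that X ⊆ B_{εR}(L) := {y ∈ ℝⁿ : dist(y, L) < εR}. -/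
/-- A subspace of a finite-dimensional space can be enlarged to any admissible dimension. -/
lemma exists_submodule_ge_finrank_eq {K V : Type*} [Field K] [AddCommGroup V] [Module K V]
    [FiniteDimensional K V] {d : ℕ} (hd : d ≤ Module.finrank K V) (W : Submodule K V)
    (hW : Module.finrank K W ≤ d) :
    ∃ W' : Submodule K V, W ≤ W' ∧ Module.finrank K W' = d := by
  obtain ⟨U, hU⟩ := W.exists_isCompl
  have hsum := Submodule.finrank_add_eq_of_isCompl hU
  obtain ⟨b, hb⟩ := exists_linearIndependent_of_le_finrank
    (R := K) (M := U) (n := d - Module.finrank K W) (by omega)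
  have hb' : LinearIndependent K (U.subtype ∘ b) := hb.map' _ U.ker_subtype
  have hspan := finrank_span_eq_card hb'
  have hle : Submodule.span K (Set.range (U.subtype ∘ b)) ≤ U :=
    Submodule.span_le.mpr (Set.range_subset_iff.mpr fun i => (b i).2)
  have hsup := Submodule.finrank_sup_add_finrank_inf_eq W
    (Submodule.span K (Set.range (U.subtype ∘ b)))
  rw [(hU.disjoint.mono_right hle).eq_bot, finrank_bot, hspan, Fintype.card_fin] at hsup
  exact ⟨W ⊔ Submodule.span K (Set.range (U.subtype ∘ b)), le_sup_left, by omega⟩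

/-- Greedy selection: either `Y` contains `m` vectors whose coefficients are controlled by the
norm of their linear combinations, or `Y` is within `r` of a subspace of dimension `< m`. -/
lemma exists_controlled_vectors_or_near_submodule {E : Type*} [NormedAddCommGroup E]
    [NormedSpace ℝ E] {q : ℝ} (hq : 0 ≤ q) (m : ℕ) :
    ∃ C > (0 : ℝ), ∀ r > (0 : ℝ), ∀ Y : Set E, (∀ y ∈ Y, ‖y‖ ≤ q * r) →
      (∃ v : Fin m → E, (∀ i, v i ∈ Y) ∧
        ∀ c : Fin m → ℝ, (∑ i, |c i|) * r ≤ C * ‖∑ i, c i • v i‖) ∨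
      ∃ W : Submodule ℝ E, Module.finrank ℝ W < m ∧ ∀ y ∈ Y, ∃ w ∈ W, dist y w < r := by
  induction m with
  | zero => exact ⟨1, one_pos, fun r _ Y _ => Or.inl ⟨Fin.elim0, fun i => i.elim0, by simp⟩⟩
  | succ m ih =>
    obtain ⟨C, hC, h⟩ := ih
    refine ⟨1 + C * (1 + q), by positivity, fun r hr Y hY => ?_⟩
    rcases h r hr Y hY with ⟨v, hvY, hv⟩ | ⟨W, hW, hYW⟩
    swap
    · exact Or.inr ⟨W, hW.trans m.lt_succ_self, hYW⟩
    by_cases hnear : ∀ y ∈ Y, ∃ w ∈ Submodule.span ℝ (Set.range v), dist y w < r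
    · exact Or.inr ⟨_, Nat.lt_succ_of_le
        (by simpa [Set.finrank] using finrank_range_le_card (R := ℝ) v),
        hnear⟩
    push Not at hnear
    obtain ⟨y, hyY, hy⟩ := hnear
    refine Or.inl ⟨Fin.snoc v y, fun i => ?_, fun c => ?_⟩
    · refine Fin.lastCases ?_ (fun j => ?_) i
      · simpa using hyY
      · simpa using hvY j
    simp only [Fin.sum_univ_castSucc, Fin.snoc_castSucc, Fin.snoc_last]
    set a := c (Fin.last m)
    set u := ∑ i : Fin m, c i.castSucc • v i with hu
    have hu_mem : u ∈ Submodule.span ℝ (Set.range v) :=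
      Submodule.sum_mem _ fun i _ =>
        Submodule.smul_mem _ _ (Submodule.subset_span (Set.mem_range_self i))
    have hlast : |a| * r ≤ ‖u + a • y‖ := by
      rcases eq_or_ne a 0 with ha | ha
      · simp [ha]
      have h1 := hy (-(a⁻¹ • u)) (Submodule.neg_mem _ (Submodule.smul_mem _ _ hu_mem))
      have h2 : u + a • y = a • (y - -(a⁻¹ • u)) := by
        rw [sub_neg_eq_add, smul_add, smul_smul, mul_inv_cancel₀ ha, one_smul, add_comm]
      rw [h2, norm_smul, Real.norm_eq_abs, ← dist_eq_norm]
      gcongr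
    have hinit := hv fun i => c i.castSucc
    have hu_le : ‖u‖ ≤ (1 + q) * ‖u + a • y‖ := calc
      ‖u‖ = ‖(u + a • y) - a • y‖ := by rw [add_sub_cancel_right]
      _ ≤ ‖u + a • y‖ + |a| * ‖y‖ := by
        rw [← Real.norm_eq_abs, ← norm_smul]; exact norm_sub_le _ _
      _ ≤ ‖u + a • y‖ + |a| * (q * r) := by gcongr; exact hY y hyY
      _ ≤ (1 + q) * ‖u + a • y‖ := by nlinarith
    have := mul_le_mul_of_nonneg_left hu_le hC.le
    nlinarith

/-- Polarization: nearly equal lengths give nearly equal inner products. -/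
lemma abs_inner_sub_inner_le {E F : Type*} [NormedAddCommGroup E] [InnerProductSpace ℝ E]
    [NormedAddCommGroup F] [InnerProductSpace ℝ F] {x y : E} {x' y' : F} {B η : ℝ}
    (hx : ‖x‖ ≤ B) (hy : ‖y‖ ≤ B) (hxy : ‖x - y‖ ≤ B)
    (hx' : |‖x‖ - ‖x'‖| ≤ η) (hy' : |‖y‖ - ‖y'‖| ≤ η) (hxy' : |‖x - y‖ - ‖x' - y'‖| ≤ η) :
    |inner ℝ x y - inner ℝ x' y'| ≤ 3 / 2 * (η * (2 * B + η)) := by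
  have key : ∀ {a b : ℝ}, 0 ≤ a → 0 ≤ b → a ≤ B → |a - b| ≤ η →
      |a * a - b * b| ≤ η * (2 * B + η) := by
    intro a b ha hb haB hab
    have h1 : a * a - b * b = (a - b) * (a + b) := by ring
    rw [h1, abs_mul, abs_of_nonneg (add_nonneg ha hb)]
    have := (abs_le.mp hab).1
    exact mul_le_mul hab (by linarith) (by positivity) ((abs_nonneg _).trans hab)
  have h1 := abs_le.mp (key (norm_nonneg x) (norm_nonneg x') hx hx')
  have h2 := abs_le.mp (key (norm_nonneg y) (norm_nonneg y') hy hy')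
  have h3 := abs_le.mp (key (norm_nonneg (x - y)) (norm_nonneg (x' - y')) hxy hxy')
  rw [real_inner_eq_norm_mul_self_add_norm_mul_self_sub_norm_sub_mul_self_div_two,
    real_inner_eq_norm_mul_self_add_norm_mul_self_sub_norm_sub_mul_self_div_two]
  exact abs_le.mpr ⟨by linarith [h1.1, h2.1, h3.2], by linarith [h1.2, h2.2, h3.1]⟩

/-- The squared norm of a linear combination in terms of the Gram matrix. -/
lemma norm_sum_smul_sq_eq {ι E : Type*} [Fintype ι] [NormedAddCommGroup E]
    [InnerProductSpace ℝ E] (c : ι → ℝ) (w : ι → E) :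
    ‖∑ i, c i • w i‖ ^ 2 = ∑ i, ∑ j, c i * c j * inner ℝ (w i) (w j) := by
  rw [← real_inner_self_eq_norm_sq, sum_inner]
  refine Finset.sum_congr rfl fun i _ => ?_
  rw [inner_sum]
  refine Finset.sum_congr rfl fun j _ => ?_
  rw [real_inner_smul_left, real_inner_smul_right]
  ring

/-- Vectors whose Gram matrix is close to that of more vectors than the dimension of the ambient
space have a normalized linear combination that is short. -/
lemma exists_short_combination {E F : Type*} [NormedAddCommGroup E] [InnerProductSpace ℝ E]
    [NormedAddCommGroup F] [InnerProductSpace ℝ F] [FiniteDimensional ℝ F] {k : ℕ}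
    (hF : Module.finrank ℝ F < k) (v : Fin k → E) (v' : Fin k → F) {M : ℝ}
    (hM : ∀ i j, |inner ℝ (v i) (v j) - inner ℝ (v' i) (v' j)| ≤ M) :
    ∃ c : Fin k → ℝ, 0 < ∑ i, |c i| ∧ ‖∑ i, c i • v i‖ ^ 2 ≤ M * (∑ i, |c i|) ^ 2 := by
  have hdep : ¬ LinearIndependent ℝ v' := fun h => by
    have := h.fintype_card_le_finrank
    simp at this
    omega
  obtain ⟨c, hc, i, hi⟩ := Fintype.not_linearIndependent_iff.mp hdep
  refine ⟨c, Finset.sum_pos' (fun _ _ => abs_nonneg _) ⟨i, Finset.mem_univ i, abs_pos.mpr hi⟩, ?_⟩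
  have hv' : ∑ i, ∑ j, c i * c j * inner ℝ (v' i) (v' j) = 0 := by
    rw [← norm_sum_smul_sq_eq, hc, norm_zero, zero_pow two_ne_zero]
  calc
    ‖∑ i, c i • v i‖ ^ 2
      = ∑ i, ∑ j, c i * c j * (inner ℝ (v i) (v j) - inner ℝ (v' i) (v' j)) := by
        simp only [mul_sub, Finset.sum_sub_distrib, hv', sub_zero, norm_sum_smul_sq_eq]
    _ ≤ ∑ i, ∑ j, |c i| * |c j| * M := by
        refine Finset.sum_le_sum fun i _ => Finset.sum_le_sum fun j _ => ?_
        refine (le_abs_self _).trans ?_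
        rw [abs_mul, abs_mul]
        gcongr
        exact hM i j
    _ = M * (∑ i, |c i|) ^ 2 := by
        rw [sq, Finset.sum_mul_sum, Finset.mul_sum]
        refine Finset.sum_congr rfl fun i _ => ?_
        rw [Finset.mul_sum]
        exact Finset.sum_congr rfl fun j _ => mul_comm _ _


noncomputable section

/-- The L²-product distance on `K × E` induced by a distance function `dK` on `K`
and the metric on `E`: `√(dK(f,g)² + dist(a,b)²)`. -/
def prodL2Dist {K : Type*} (dK : K → K → ℝ) {E : Type*} [PseudoMetricSpace E]
    (p q : K × E) : ℝ :=
  Real.sqrt (dK p.1 q.1 ^ 2 + dist p.2 q.2 ^ 2)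

/-- A configuration of `k+1` points of `X` (with distance function `dX`) is
`(k,α)`-independent in a ball of radius `R` if there is no `0 ≤ l < k` and no
points `x'_0, …, x'_k ∈ ℝ^l` with `|dX(x_i,x_j) − |x'_i − x'_j|| < α·R` for all
`i, j`. -/
def IsKIndep {X : Type*} (k : ℕ) (α R : ℝ) (dX : X → X → ℝ)
    (x : Fin (k + 1) → X) : Prop :=
  ¬ ∃ l : ℕ, l < k ∧ ∃ x' : Fin (k + 1) → EuclideanSpace ℝ (Fin l),
      ∀ i j, |dX (x i) (x j) - dist (x' i) (x' j)| < α * R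

/-- A configuration of `k+1` points of `X` (with distance function `dX`) is
`(k,α,D)`-independent in a ball of radius `R` if there is no `0 ≤ l < k`, no
compact metric space `K` with `diam(K) ≤ D`, and no points
`x'_0, …, x'_k ∈ K × ℝ^l` (with the L²-product metric) such that
`|dX(x_i,x_j) − d_{K×ℝ^l}(x'_i,x'_j)| < D + α·R` for all `i, j`. -/
def IsKDIndep {X : Type*} (k : ℕ) (α R D : ℝ) (dX : X → X → ℝ)
    (x : Fin (k + 1) → X) : Prop :=
  ¬ ∃ l : ℕ, l < k ∧ ∃ (K : Type) (mK : MetricSpace K),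
      @CompactSpace K mK.toPseudoMetricSpace.toUniformSpace.toTopologicalSpace ∧
      @Metric.diam K mK.toPseudoMetricSpace Set.univ ≤ D ∧
      ∃ x' : Fin (k + 1) → K × EuclideanSpace ℝ (Fin l),
        ∀ i j, |dX (x i) (x j) -
          prodL2Dist (@dist K mK.toPseudoMetricSpace.toDist) (x' i) (x' j)| < D + α * R

/-- **Absence of independent subsets forces proximity to a plane** (Remark 2.2).
For every `n ≥ 1`, `1 ≤ k ≤ n` and `ε > 0` there is `δ₀ = δ₀(n,ε) > 0` such that
for all `0 < δ ≤ δ₀` and `R > 0`: if `X ⊆ B(0,R) ⊆ ℝⁿ` contains no `(k+1)`-point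
configuration that is `(k,δ)`-independent in `B(0,R)`, then there is an affine
subspace `L ⊆ ℝⁿ` of dimension `k−1` with `X ⊆ B_{εR}(L)`. -/
theorem near_plane_of_no_indep (n : ℕ) (hn : 1 ≤ n) (k : ℕ) (hk1 : 1 ≤ k)
    (hkn : k ≤ n) (ε : ℝ) (hε : 0 < ε) :
    ∃ δ₀ > (0 : ℝ), ∀ δ : ℝ, 0 < δ → δ ≤ δ₀ → ∀ R : ℝ, 0 < R →
      ∀ X : Set (EuclideanSpace ℝ (Fin n)), X ⊆ Metric.ball 0 R →
        (∀ x : Fin (k + 1) → EuclideanSpace ℝ (Fin n), (∀ i, x i ∈ X) →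
          ¬ IsKIndep k δ R dist x) →
        ∃ L : AffineSubspace ℝ (EuclideanSpace ℝ (Fin n)),
          (L : Set (EuclideanSpace ℝ (Fin n))).Nonempty ∧
          Module.finrank ℝ L.direction = k - 1 ∧
          X ⊆ Metric.thickening (ε * R) (L : Set (EuclideanSpace ℝ (Fin n))) := by
  obtain ⟨C, hC, hgreedy⟩ := exists_controlled_vectors_or_near_submodule
    (E := EuclideanSpace ℝ (Fin n)) (q := 2 / ε) (by positivity) k
  refine ⟨min 1 (ε ^ 2 / (14 * C ^ 2)), by positivity, fun δ hδ hδ_le R hR X hX hindep => ?_⟩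
  have hδ1 : δ ≤ 1 := hδ_le.trans (min_le_left _ _)
  have hδC : δ * (14 * C ^ 2) ≤ ε ^ 2 :=
    (le_div_iff₀ (by positivity)).mp (hδ_le.trans (min_le_right _ _))
  have hfin : k - 1 ≤ Module.finrank ℝ (EuclideanSpace ℝ (Fin n)) := by
    rw [finrank_euclideanSpace_fin]
    omega
  rcases X.eq_empty_or_nonempty with rfl | ⟨p, hp⟩
  · obtain ⟨W, -, hW⟩ := exists_submodule_ge_finrank_eq hfin
      (⊥ : Submodule ℝ (EuclideanSpace ℝ (Fin n))) (by simp)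
    exact ⟨AffineSubspace.mk' 0 W, ⟨0, AffineSubspace.self_mem_mk' _ _⟩,
      by rwa [AffineSubspace.direction_mk'], Set.empty_subset _⟩
  have hdist : ∀ x ∈ X, ∀ y ∈ X, ‖x - y‖ ≤ 2 * R := fun x hx y hy => by
    have h1 := mem_ball_zero_iff.mp (hX hx)
    have h2 := mem_ball_zero_iff.mp (hX hy)
    linarith [norm_sub_le x y]
  rcases hgreedy (ε * R) (by positivity) {y | y + p ∈ X} (fun y hy => by
      have := hdist _ hy p hp
      rw [add_sub_cancel_right] at this
      rwa [show 2 / ε * (ε * R) = 2 * R by field_simp]) with ⟨v, hvX, hv⟩ | ⟨W, hW, hnear⟩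
  · exfalso
    refine hindep (Fin.cons p fun i => v i + p) (fun i => ?_) ?_
    · refine Fin.cases ?_ (fun j => ?_) i
      · simpa using hp
      · simpa using hvX j
    rintro ⟨l, hl, x', hx'⟩
    have hv0 : ∀ i, ‖v i‖ ≤ 2 * R := fun i => by
      simpa using hdist _ (hvX i) p hp
    have hvv : ∀ i j, ‖v i - v j‖ ≤ 2 * R := fun i j => by
      simpa using hdist _ (hvX i) _ (hvX j)
    have hx0 : ∀ i, |‖v i‖ - ‖x' i.succ - x' 0‖| ≤ δ * R := fun i => by
      simpa [dist_eq_norm] using (hx' i.succ 0).le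
    have hxx : ∀ i j, |‖v i - v j‖ - ‖(x' i.succ - x' 0) - (x' j.succ - x' 0)‖| ≤ δ * R :=
      fun i j => by simpa [dist_eq_norm] using (hx' i.succ j.succ).le
    obtain ⟨c, hc, hshort⟩ := exists_short_combination (by simpa using hl) v
      (fun i => x' i.succ - x' 0)
      fun i j => abs_inner_sub_inner_le (hv0 i) (hv0 j) (hvv i j) (hx0 i) (hx0 j) (hxx i j)
    set S := ∑ i, |c i|
    have hlong : (S * (ε * R)) ^ 2 ≤ (C * ‖∑ i, c i • v i‖) ^ 2 :=
      pow_le_pow_left₀ (by positivity) (hv c) 2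
    have hSR : 0 < (S * R) ^ 2 := by positivity
    have h1 : (S * R) ^ 2 * ε ^ 2 ≤ (S * R) ^ 2 * (C ^ 2 * (3 / 2 * (δ * (4 + δ)))) := by
      have := mul_le_mul_of_nonneg_left hshort (sq_nonneg C)
      nlinarith
    have h2 := le_of_mul_le_mul_left h1 hSR
    have h3 : 0 < δ * C ^ 2 := by positivity
    nlinarith
  · obtain ⟨W', hWW', hW'⟩ := exists_submodule_ge_finrank_eq hfin W (by omega)
    refine ⟨AffineSubspace.mk' p W', ⟨p, AffineSubspace.self_mem_mk' _ _⟩,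
      by rwa [AffineSubspace.direction_mk'], fun x hx => ?_⟩
    obtain ⟨w, hw, hxw⟩ := hnear (x - p) (by simpa using hx)
    refine Metric.mem_thickening_iff.mpr ⟨w + p, ?_, ?_⟩
    · simpa [AffineSubspace.mem_mk'] using hWW' hw
    · rwa [dist_eq_norm, show x - (w + p) = x - p - w by abel, ← dist_eq_norm]
end
end
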